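/- Let 3 ≤ i ≤ m and let p and q be semi-normalized m-tuples in ℍ^{n+1} (each with its first i entries null and remaining entries negative), with Gram matrices G₁ and G₂. Then p and q are PSp(n,1)-congruent if and only if there exists a unit quaternion μ such that (G₁)_{kj} = conj(μ)·(G₂)_{kj}·μ for all k, j. -/

import Mathlib

noncomputable section

open Quaternion Matrix
open scoped Classical

abbrev ℍq : Type := Quaternion ℝ

/-- Hermitian form matrix of signature (n,1). -/
def qHmat (n : ℕ) : Matrix (Fin (n+1)) (Fin (n+1)) ℍq := fun k j =>
  if (k = 0 ∧ j = Fin.last n) ∨ (k = Fin.last n ∧ j = 0) then 1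
  else if k = j ∧ k ≠ 0 ∧ k ≠ Fin.last n then 1 else 0

/-- `herm n z w = ⟨z,w⟩ = w* H z`. -/
def herm (n : ℕ) (z w : Fin (n+1) → ℍq) : ℍq :=
  ∑ k, ∑ j, star (w k) * qHmat n k j * z j

/-- Two `m`-tuples of vectors are PSp(n,1)-congruent if some `C ∈ Sp(n,1)` carries each
`p k` to `q k` up to a nonzero right quaternionic scalar. -/
def PSpCongruent (n m : ℕ) (p q : Fin m → Fin (n+1) → ℍq) : Prop :=
  ∃ C : Matrix (Fin (n+1)) (Fin (n+1)) ℍq, Cᴴ * qHmat n * C = qHmat n ∧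
    ∃ μ : Fin m → ℍq, (∀ k, μ k ≠ 0) ∧ ∀ k, C.mulVec (p k) = fun j => q k j * μ k

/-- An `m`-tuple `p` (first `i` entries null, the rest negative, pairwise projectively
distinct) is semi-normalized if its Gram matrix `g_{kj} = ⟨p_j, p_k⟩` satisfies
`g_{kk} = 0` for `1 ≤ k ≤ i`, `|g_{23}| = 1`, `g_{1j} = 1` for `2 ≤ j ≤ i`,
`g_{kk} = −1` for `i+1 ≤ k ≤ m`, and `g_{1j}` positive real for `i+1 ≤ j ≤ m`
(1-based indexing). -/
def SemiNormalized (n m i : ℕ) (p : Fin m → Fin (n+1) → ℍq) : Prop :=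
  (∀ k, p k ≠ 0) ∧
  (∀ k l : Fin m, k ≠ l → ∀ c : ℍq, p k ≠ fun j => p l j * c) ∧
  (∀ k : Fin m, (k : ℕ) < i → herm n (p k) (p k) = 0) ∧
  (∀ k j : Fin m, (k : ℕ) = 1 → (j : ℕ) = 2 → ‖herm n (p j) (p k)‖ = 1) ∧
  (∀ k j : Fin m, (k : ℕ) = 0 → 1 ≤ (j : ℕ) → (j : ℕ) < i → herm n (p j) (p k) = 1) ∧
  (∀ k : Fin m, i ≤ (k : ℕ) → herm n (p k) (p k) = -1) ∧
  (∀ k j : Fin m, (k : ℕ) = 0 → i ≤ (j : ℕ) → ∃ r : ℝ, 0 < r ∧ herm n (p j) (p k) = (r : ℍq))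

/-- The Korányi–Reimann quaternionic cross ratio. -/
def crossRatio (n : ℕ) (z1 z2 z3 z4 : Fin (n+1) → ℍq) : ℍq :=
  herm n z3 z1 * (herm n z3 z2)⁻¹ * herm n z4 z2 * (herm n z4 z1)⁻¹

/-- The quaternionic Cartan angular invariant
`𝔸(z₁,z₂,z₃) = arccos(Re(−T)/|T|)` with `T = ⟨z₁,z₂⟩⟨z₂,z₃⟩⟨z₃,z₁⟩`. -/
def angInv (n : ℕ) (z1 z2 z3 : Fin (n+1) → ℍq) : ℝ :=
  Real.arccos ((-(herm n z1 z2 * herm n z2 z3 * herm n z3 z1)).re /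
    ‖herm n z1 z2 * herm n z2 z3 * herm n z3 z1‖)

/-- The rotation invariant `u(g) = Im g / |Im g|` (and `0` if `Im g = 0`). -/
def rotInv (g : ℍq) : ℍq := if g.im = 0 then 0 else (‖g.im‖)⁻¹ • g.im

/-- The distance invariant `d(z,w) = (⟨w,z⟩·⟨z,w⟩)/(⟨w,w⟩·⟨z,z⟩)`. -/
def dInv (n : ℕ) (z w : Fin (n+1) → ℍq) : ℍq :=
  (herm n w z * herm n z w) / (herm n w w * herm n z z)

theorem qHmat_apply (n : ℕ) (k j : Fin (n + 1)) :
    qHmat n k j = if j = Equiv.swap 0 (Fin.last n) k then 1 else 0 := by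
  unfold qHmat
  by_cases h0 : k = 0
  · subst h0
    by_cases hj : j = Fin.last n <;> simp [hj]
    intro h1 h2
    exact absurd (Fin.ext (by simp [h1, h2])) hj
  · by_cases hl : k = Fin.last n
    · subst hl
      by_cases hj : j = 0 <;> simp [hj, h0]
    · rw [Equiv.swap_apply_of_ne_of_ne h0 hl]
      simp [h0, hl, eq_comm]

theorem herm_eq_sum_swap (n : ℕ) (z w : Fin (n + 1) → ℍq) :
    herm n z w = ∑ k, star (w k) * z (Equiv.swap 0 (Fin.last n) k) := by
  simp [herm, qHmat_apply]

theorem herm_eq_dotProduct (n : ℕ) (z w : Fin (n + 1) → ℍq) :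
    herm n z w = star w ⬝ᵥ (qHmat n *ᵥ z) := by
  simp [herm, dotProduct, mulVec, Finset.mul_sum, mul_assoc]

theorem star_herm (n : ℕ) (z w : Fin (n + 1) → ℍq) : star (herm n z w) = herm n w z := by
  rw [herm_eq_sum_swap, herm_eq_sum_swap, star_sum,
    ← Equiv.sum_comp (Equiv.swap 0 (Fin.last n))]
  simp

theorem herm_sub_left (n : ℕ) (x y w : Fin (n + 1) → ℍq) :
    herm n (x - y) w = herm n x w - herm n y w := by
  simp [herm_eq_sum_swap, mul_sub]

theorem herm_sub_right (n : ℕ) (z x y : Fin (n + 1) → ℍq) :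
    herm n z (x - y) = herm n z x - herm n z y := by
  simp [herm_eq_sum_swap, sub_mul]

theorem herm_mul_left (n : ℕ) (z w : Fin (n + 1) → ℍq) (c : ℍq) :
    herm n (fun j => z j * c) w = herm n z w * c := by
  simp [herm_eq_sum_swap, Finset.sum_mul, mul_assoc]

theorem herm_mul_right (n : ℕ) (z w : Fin (n + 1) → ℍq) (c : ℍq) :
    herm n z (fun j => w j * c) = star c * herm n z w := by
  simp [herm_eq_sum_swap, Finset.mul_sum, mul_assoc]

/-- A matrix lies in `Sp(n,1)` exactly when it preserves the Hermitian form. -/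
theorem conjTranspose_mul_qHmat_mul_iff (n : ℕ) (C : Matrix (Fin (n + 1)) (Fin (n + 1)) ℍq) :
    Cᴴ * qHmat n * C = qHmat n ↔
      ∀ z w, herm n (C *ᵥ z) (C *ᵥ w) = herm n z w := by
  have key : ∀ z w, herm n (C *ᵥ z) (C *ᵥ w) = star w ⬝ᵥ ((Cᴴ * qHmat n * C) *ᵥ z) := by
    intro z w
    rw [herm_eq_dotProduct, star_mulVec, ← dotProduct_mulVec, mulVec_mulVec, mulVec_mulVec,
      Matrix.mul_assoc]
  constructor
  · intro h z w
    rw [key, h, herm_eq_dotProduct]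
  · intro h
    ext1 k j
    have := h (Pi.single j 1) (Pi.single k 1)
    rw [key, herm_eq_dotProduct] at this
    simpa using this

/-- Splitting of the Hermitian form into its positive and its negative part. -/
theorem four_mul_herm (n : ℕ) (z w : Fin (n + 1) → ℍq) :
    4 * herm n z w =
      (∑ k, star (w k + w (Equiv.swap 0 (Fin.last n) k)) *
        (z k + z (Equiv.swap 0 (Fin.last n) k)))
      - 2 * (star (w 0 - w (Fin.last n)) * (z 0 - z (Fin.last n))) := by
  have h1 : ∑ k, star (w k - w (Equiv.swap 0 (Fin.last n) k)) *
      (z k - z (Equiv.swap 0 (Fin.last n) k)) =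
      2 * (star (w 0 - w (Fin.last n)) * (z 0 - z (Fin.last n))) := by
    by_cases h0 : (0 : Fin (n + 1)) = Fin.last n
    · simp [← h0]
    · rw [Fintype.sum_eq_add 0 (Fin.last n) h0]
      · simp only [Equiv.swap_apply_left, Equiv.swap_apply_right, star_sub]
        noncomm_ring
      · rintro k ⟨hk, hk'⟩
        simp [Equiv.swap_apply_of_ne_of_ne hk hk']
  have h2 : ∑ k, star (w (Equiv.swap 0 (Fin.last n) k)) * z k = herm n z w := by
    rw [herm_eq_sum_swap, ← Equiv.sum_comp (Equiv.swap 0 (Fin.last n))]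
    simp
  rw [← h1, ← Finset.sum_sub_distrib]
  calc 4 * herm n z w = 2 * herm n z w + 2 * herm n z w := by noncomm_ring
    _ = ∑ k, (2 * (star (w k) * z (Equiv.swap 0 (Fin.last n) k)) +
          2 * (star (w (Equiv.swap 0 (Fin.last n) k)) * z k)) := by
      rw [Finset.sum_add_distrib, ← Finset.mul_sum, ← Finset.mul_sum, h2, ← herm_eq_sum_swap]
    _ = _ := by
      refine Finset.sum_congr rfl fun k _ => ?_
      simp only [star_add, star_sub]
      noncomm_ring

theorem four_mul_herm_self_re (n : ℕ) (z : Fin (n + 1) → ℍq) :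
    4 * (herm n z z).re =
      (∑ k, ‖z k + z (Equiv.swap 0 (Fin.last n) k)‖ ^ 2) - 2 * ‖z 0 - z (Fin.last n)‖ ^ 2 := by
  have hs : ∀ a : ℍq, star a * a = ((‖a‖ ^ 2 : ℝ) : ℍq) := fun a => by
    rw [Quaternion.star_mul_self, Quaternion.normSq_eq_norm_mul_self, sq]
  have h := congrArg (fun a : ℍq => a.re) (four_mul_herm n z z)
  have h4 : (4 : ℍq) = ((4 : ℝ) : ℍq) := rfl
  have h2 : (2 : ℍq) = ((2 : ℝ) : ℍq) := rfl
  simp only [hs, h2, h4, Quaternion.coe_mul_eq_smul, Quaternion.re_smul,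
    Quaternion.re_sub, Quaternion.re_coe, smul_eq_mul] at h
  rw [h]
  congr 1
  exact map_sum (QuaternionAlgebra.reₗ (-1) 0 (-1) : ℍq →ₗ[ℝ] ℝ) _ _

/-- The orthogonal complement of a negative vector is positive definite. -/
theorem eq_zero_of_herm_eq_zero_of_re_nonpos (n : ℕ) {t v : Fin (n + 1) → ℍq}
    (ht : (herm n t t).re < 0) (hvt : herm n v t = 0) (hv : (herm n v v).re ≤ 0) : v = 0 := by
  set σ := Equiv.swap 0 (Fin.last n) with hσ
  have et := four_mul_herm_self_re n t
  have ev := four_mul_herm_self_re n v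
  have evt := four_mul_herm n v t
  rw [← hσ] at et ev evt
  rw [hvt, mul_zero, eq_comm, sub_eq_zero] at evt
  have hn := congrArg norm evt
  have hle : 2 * (‖t 0 - t (Fin.last n)‖ * ‖v 0 - v (Fin.last n)‖) ≤
      ∑ k, ‖t k + t (σ k)‖ * ‖v k + v (σ k)‖ := by
    have h2 : ‖(2 : ℍq)‖ = 2 := by
      exact (Quaternion.norm_coe (2 : ℝ)).trans Real.norm_two
    rw [norm_mul, norm_mul, _root_.norm_star, h2] at hn
    rw [← hn]
    refine (norm_sum_le _ _).trans (le_of_eq ?_)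
    simp only [norm_mul, _root_.norm_star]
  have hcs := Finset.sum_mul_sq_le_sq_mul_sq Finset.univ
    (fun k => ‖t k + t (σ k)‖) (fun k => ‖v k + v (σ k)‖)
  have hB0 : 0 ≤ ∑ k, ‖v k + v (σ k)‖ ^ 2 := Finset.sum_nonneg fun _ _ => sq_nonneg _
  have hA0 : 0 ≤ ∑ k, ‖t k + t (σ k)‖ ^ 2 := Finset.sum_nonneg fun _ _ => sq_nonneg _
  set A := ∑ k, ‖t k + t (σ k)‖ ^ 2
  set B := ∑ k, ‖v k + v (σ k)‖ ^ 2 with hB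
  have hsq := (pow_le_pow_left₀
    (mul_nonneg two_pos.le (mul_nonneg (norm_nonneg _) (norm_nonneg _))) hle 2).trans hcs
  have hS : ‖v 0 - v (Fin.last n)‖ = 0 := by
    by_contra hne
    have hpos : 0 < ‖v 0 - v (Fin.last n)‖ ^ 2 := by positivity
    nlinarith [mul_le_mul_of_nonneg_left (show B ≤ 2 * ‖v 0 - v (Fin.last n)‖ ^ 2 by linarith) hA0,
      mul_lt_mul_of_pos_right (show A < 2 * ‖t 0 - t (Fin.last n)‖ ^ 2 by linarith) hpos]
  have hBz : B = 0 := by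
    rw [hS] at ev
    linarith
  rw [hB, Finset.sum_eq_zero_iff_of_nonneg fun _ _ => sq_nonneg _] at hBz
  have hP : ∀ k, v k + v (σ k) = 0 := fun k => by simpa using hBz k (Finset.mem_univ k)
  have hM : ∀ k, v (σ k) = v k := by
    rw [norm_eq_zero, sub_eq_zero] at hS
    intro k
    by_cases h0 : k = 0
    · simp [hσ, h0, hS]
    by_cases hl : k = Fin.last n
    · simp [hσ, hl, hS]
    · rw [hσ, Equiv.swap_apply_of_ne_of_ne h0 hl]
  funext k
  have := hP k
  rw [hM k, ← two_smul ℝ] at this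
  exact (smul_eq_zero.mp this).resolve_left two_ne_zero

/-- A quasi-reflection along `x - y` carries `x` to `y` and fixes every vector whose products with
`x` and `y` agree. -/
theorem exists_isometry_mulVec_eq (n : ℕ) {x y : Fin (n + 1) → ℍq}
    (hxy : herm n x x = herm n y y) (hne : x ≠ y → herm n x (x - y) ≠ 0) :
    ∃ C : Matrix (Fin (n + 1)) (Fin (n + 1)) ℍq,
      (∀ z w, herm n (C *ᵥ z) (C *ᵥ w) = herm n z w) ∧ C *ᵥ x = y ∧
      ∀ z, herm n z x = herm n z y → C *ᵥ z = z := by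
  by_cases h : x = y
  · exact ⟨1, by simp, by simpa using h, by simp⟩
  have ha := hne h
  obtain ⟨v, hv⟩ : ∃ v, v = x - y := ⟨_, rfl⟩
  obtain ⟨a, haa⟩ : ∃ a, a = (herm n x v)⁻¹ := ⟨_, rfl⟩
  rw [← hv] at ha
  have hax : a * herm n x v = 1 := haa ▸ inv_mul_cancel₀ ha
  have hvv : herm n v v = herm n x v + herm n v x := by
    simp only [hv, herm_sub_left, herm_sub_right, hxy]
    abel
  have hC : ∀ z, (1 - vecMulVec (fun k => v k * a) (star v ᵥ* qHmat n)) *ᵥ z =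
      z - fun k => v k * (a * herm n z v) := by
    intro z
    rw [sub_mulVec, one_mulVec]
    congr 1
    funext k
    rw [herm_eq_dotProduct, dotProduct_mulVec]
    simp [mulVec, vecMulVec_apply, dotProduct, Finset.mul_sum, mul_assoc]
  refine ⟨1 - vecMulVec (fun k => v k * a) (star v ᵥ* qHmat n), ?_, ?_, ?_⟩
  · intro z w
    have hid : star a * herm n v v * a = a + star a := by
      have h1 : herm n x v * a = 1 := by rw [haa, mul_inv_cancel₀ ha]
      have h2 : star a * herm n v x = 1 := by
        rw [← star_herm n x v, ← star_mul, h1, star_one]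
      rw [hvv, mul_add, h2, add_mul, mul_assoc, h1, mul_one, one_mul, add_comm]
    rw [hC, hC]
    simp only [herm_sub_left, herm_sub_right, herm_mul_left, herm_mul_right, star_mul, star_herm]
    have : herm n v w * star a * (herm n v v * (a * herm n z v)) =
        herm n v w * (star a * herm n v v * a) * herm n z v := by noncomm_ring
    rw [mul_sub, this, hid]
    noncomm_ring
  · rw [hC, hax, hv]
    funext k
    simp
  · intro z hz
    rw [hC, show herm n z v = 0 by rw [hv, herm_sub_right, hz, sub_self]]
    funext k
    simp

/-- Hyperbolic pairs can be carried to one another by an isometry. -/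
theorem exists_isometry_of_hyperbolic_pairs (n : ℕ) {e f e' f' : Fin (n + 1) → ℍq}
    (he : herm n e e = 0) (hf : herm n f f = 0) (hfe : herm n f e = 1)
    (he' : herm n e' e' = 0) (hf' : herm n f' f' = 0) (hfe' : herm n f' e' = 1) :
    ∃ C : Matrix (Fin (n + 1)) (Fin (n + 1)) ℍq,
      (∀ z w, herm n (C *ᵥ z) (C *ᵥ w) = herm n z w) ∧ C *ᵥ e = e' ∧ C *ᵥ f = f' := by
  have hstar : ∀ {x y : Fin (n + 1) → ℍq}, herm n x y = 1 → herm n y x = 1 := fun h => by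
    rw [← star_herm, h, star_one]
  have hneg : ∀ {x y : Fin (n + 1) → ℍq}, herm n x x = 0 → herm n y y = 0 → herm n y x = 1 →
      (herm n (x - y) (x - y)).re < 0 := fun h1 h2 h3 => by
    simp [herm_sub_left, herm_sub_right, h1, h2, h3, hstar h3]
  have hmove : ∀ {x y : Fin (n + 1) → ℍq}, herm n x x = 0 → herm n y y = 0 → herm n x y ≠ 0 →
      ∃ C : Matrix (Fin (n + 1)) (Fin (n + 1)) ℍq,
        (∀ z w, herm n (C *ᵥ z) (C *ᵥ w) = herm n z w) ∧ C *ᵥ x = y := by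
    intro x y h1 h2 h3
    obtain ⟨C, hC, hx, -⟩ := exists_isometry_mulVec_eq n (h1.trans h2.symm)
      fun _ => by rwa [herm_sub_right, h1, zero_sub, neg_ne_zero]
    exact ⟨C, hC, hx⟩
  obtain ⟨C, hC, hCe⟩ : ∃ C : Matrix (Fin (n + 1)) (Fin (n + 1)) ℍq,
      (∀ z w, herm n (C *ᵥ z) (C *ᵥ w) = herm n z w) ∧ C *ᵥ e = e' := by
    by_cases h1 : herm n e e' = 0
    · by_cases h2 : herm n f e' = 0
      · have h0 : e' = 0 := by
          refine eq_zero_of_herm_eq_zero_of_re_nonpos n (hneg he hf hfe) ?_ (by simp [he'])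
          rw [herm_sub_right, ← star_herm n e e', ← star_herm n f e', h1, h2, sub_self]
        simp [h0, herm_eq_sum_swap] at hfe'
      · obtain ⟨C₁, h₁, hef⟩ := hmove he hf (by simp [hstar hfe])
        obtain ⟨C₂, h₂, hfe₂⟩ := hmove hf he' h2
        exact ⟨C₂ * C₁, fun z w => by simp only [← mulVec_mulVec, h₁, h₂],
          by rw [← mulVec_mulVec, hef, hfe₂]⟩
    · exact hmove he he' h1
  have hCf : herm n (C *ᵥ f) (C *ᵥ f) = 0 := by rw [hC, hf]
  have hCfe : herm n (C *ᵥ f) e' = 1 := by rw [← hCe, hC, hfe]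
  obtain ⟨D, hD, hDf, hfix⟩ := exists_isometry_mulVec_eq n (x := C *ᵥ f) (y := f')
    (hCf.trans hf'.symm) (by
      intro hne h
      refine hne (sub_eq_zero.mp ?_)
      have h' : herm n (C *ᵥ f - f') (C *ᵥ f) = 0 := by rw [← star_herm, h, star_zero]
      have h'' : herm n (C *ᵥ f) f' = 0 := by simpa [herm_sub_right, hCf] using h
      refine eq_zero_of_herm_eq_zero_of_re_nonpos n (hneg he' hCf hCfe) ?_ ?_
      · rw [herm_sub_right, h', herm_sub_left, hCfe, hfe']
        simp
      · rw [herm_sub_right, h', herm_sub_left, h'', hf']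
        simp)
  refine ⟨D * C, fun z w => by simp only [← mulVec_mulVec, hC, hD], ?_, ?_⟩
  · rw [← mulVec_mulVec, hCe, hfix]
    rw [hstar hCfe, hstar hfe']
  · rw [← mulVec_mulVec, hDf]

/-- Tuples beginning with a hyperbolic pair and having equal Gram matrices are isometric. -/
theorem exists_isometry_of_gram_eq (n m : ℕ) (hm : 2 ≤ m) (p q : Fin m → Fin (n + 1) → ℍq)
    (h0 : herm n (p ⟨0, by omega⟩) (p ⟨0, by omega⟩) = 0)
    (h1 : herm n (p ⟨1, by omega⟩) (p ⟨1, by omega⟩) = 0)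
    (h10 : herm n (p ⟨1, by omega⟩) (p ⟨0, by omega⟩) = 1)
    (hG : ∀ k j, herm n (p j) (p k) = herm n (q j) (q k)) :
    ∃ C : Matrix (Fin (n + 1)) (Fin (n + 1)) ℍq,
      (∀ z w, herm n (C *ᵥ z) (C *ᵥ w) = herm n z w) ∧ ∀ k, C *ᵥ p k = q k := by
  suffices H : ∀ l, 2 ≤ l → l ≤ m → ∃ C : Matrix (Fin (n + 1)) (Fin (n + 1)) ℍq,
      (∀ z w, herm n (C *ᵥ z) (C *ᵥ w) = herm n z w) ∧
        ∀ k : Fin m, (k : ℕ) < l → C *ᵥ p k = q k by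
    obtain ⟨C, hC, h⟩ := H m hm le_rfl
    exact ⟨C, hC, fun k => h k k.2⟩
  intro l hl
  induction l, hl using Nat.le_induction with
  | base =>
    intro _
    obtain ⟨C, hC, hCe, hCf⟩ := exists_isometry_of_hyperbolic_pairs n h0 h1 h10
      (hG _ _ ▸ h0) (hG _ _ ▸ h1) (hG _ _ ▸ h10)
    refine ⟨C, hC, fun ⟨k, hk⟩ hk2 => ?_⟩
    simp only at hk2
    interval_cases k
    · exact hCe
    · exact hCf
  | succ l hl ih =>
    intro hlm
    obtain ⟨C, hC, hCp⟩ := ih (by omega)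
    have hx : ∀ k : Fin m, (k : ℕ) < l →
        herm n (C *ᵥ p ⟨l, by omega⟩) (q k) = herm n (q ⟨l, by omega⟩) (q k) := fun k hk => by
      rw [← hCp k hk, hC, hG, hCp k hk]
    have hxx : herm n (C *ᵥ p ⟨l, by omega⟩) (C *ᵥ p ⟨l, by omega⟩) =
        herm n (q ⟨l, by omega⟩) (q ⟨l, by omega⟩) := by rw [hC, hG]
    have h01 : herm n (p ⟨0, by omega⟩) (p ⟨1, by omega⟩) = 1 := by
      rw [← star_herm, h10, star_one]
    obtain ⟨D, hD, hDx, hfix⟩ := exists_isometry_mulVec_eq n hxx (by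
      intro hne h
      refine hne (sub_eq_zero.mp ?_)
      refine eq_zero_of_herm_eq_zero_of_re_nonpos n
        (t := q ⟨0, by omega⟩ - q ⟨1, by omega⟩) ?_ ?_ ?_
      · simp [herm_sub_left, herm_sub_right, ← hG, h0, h1, h10, h01]
      · rw [herm_sub_right, herm_sub_left, herm_sub_left, hx _ (by simp; omega),
          hx _ (by simp; omega)]
        simp
      · have h' := congrArg star h
        rw [star_herm, star_zero] at h'
        rw [herm_sub_right, sub_eq_zero, hxx] at h
        rw [herm_sub_right, h', herm_sub_left, ← h]
        simp)
    refine ⟨D * C, fun z w => by simp only [← mulVec_mulVec, hC, hD], fun k hk => ?_⟩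
    rw [← mulVec_mulVec]
    rcases Nat.lt_succ_iff_lt_or_eq.mp hk with hk | hk
    · rw [hCp k hk]
      apply hfix
      rw [← star_herm, hx k hk, star_herm]
    · rwa [show k = ⟨l, by omega⟩ from Fin.ext hk]

/-- **Congruence of semi-normalized tuples.** Two semi-normalized `m`-tuples are
PSp(n,1)-congruent if and only if their Gram matrices are conjugate entrywise by a
single unit quaternion. -/
theorem semi_normalized_congruent_iff (n m i : ℕ) (hi : 3 ≤ i) (him : i ≤ m)
    (p q : Fin m → Fin (n+1) → ℍq)
    (hp : SemiNormalized n m i p) (hq : SemiNormalized n m i q) :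
    PSpCongruent n m p q ↔
      (∃ μ : ℍq, ‖μ‖ = 1 ∧
        ∀ k j : Fin m, herm n (p j) (p k) = star μ * herm n (q j) (q k) * μ) := by
  have hm0 : 0 < m := by omega
  have hm1 : 1 < m := by omega
  have hm2 : 2 < m := by omega
  constructor
  · rintro ⟨C, hC, ν, hν, hCν⟩
    rw [conjTranspose_mul_qHmat_mul_iff] at hC
    have hG : ∀ k j, herm n (p j) (p k) = star (ν k) * herm n (q j) (q k) * ν j := fun k j => by
      rw [← hC, hCν, hCν, herm_mul_left, herm_mul_right]
    obtain ⟨-, -, -, hp23, hp1, hpn, hpr⟩ := hp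
    obtain ⟨-, -, -, hq23, hq1, hqn, hqr⟩ := hq
    have hnull : ∀ j : Fin m, 1 ≤ (j : ℕ) → (j : ℕ) < i → star (ν ⟨0, hm0⟩) * ν j = 1 := by
      intro j h1 h2
      have := hG ⟨0, hm0⟩ j
      rwa [hp1 _ _ rfl h1 h2, hq1 _ _ rfl h1 h2, mul_one, eq_comm] at this
    have hs0 : star (ν ⟨0, hm0⟩) ≠ 0 := star_ne_zero.mpr (hν _)
    have h12 : ν ⟨2, hm2⟩ = ν ⟨1, hm1⟩ :=
      mul_left_cancel₀ hs0 ((hnull _ (by simp) (by simp; omega)).trans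
        (hnull _ (by simp) (by simp; omega)).symm)
    have hnorm1 : ‖ν ⟨1, hm1⟩‖ = 1 := by
      have := congrArg norm (hG ⟨1, hm1⟩ ⟨2, hm2⟩)
      rw [norm_mul, norm_mul, _root_.norm_star, hp23 _ _ rfl rfl,
        hq23 _ _ rfl rfl, h12, mul_one] at this
      nlinarith [norm_nonneg (ν ⟨1, hm1⟩)]
    have hstar_mul : star (ν ⟨1, hm1⟩) * ν ⟨1, hm1⟩ = 1 := by
      rw [Quaternion.star_mul_self, Quaternion.normSq_eq_norm_mul_self, hnorm1]
      simp
    have hs01 : star (ν ⟨0, hm0⟩) = star (ν ⟨1, hm1⟩) :=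
      mul_right_cancel₀ (hν ⟨1, hm1⟩)
        ((hnull _ (by simp) (by simp; omega)).trans hstar_mul.symm)
    refine ⟨ν ⟨1, hm1⟩, hnorm1, ?_⟩
    have hall : ∀ j, ν j = ν ⟨1, hm1⟩ := by
      intro j
      rcases lt_or_ge (j : ℕ) i with hji | hji
      · rcases Nat.eq_zero_or_pos (j : ℕ) with hj0 | hj0
        · obtain rfl : j = ⟨0, hm0⟩ := Fin.ext hj0
          exact star_injective hs01
        · refine mul_left_cancel₀ hs0 ((hnull j hj0 hji).trans ?_)
          rw [hs01, hstar_mul]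
      · obtain ⟨r, hr, hpr⟩ := hpr ⟨0, hm0⟩ j rfl hji
        obtain ⟨s, hs, hqs⟩ := hqr ⟨0, hm0⟩ j rfl hji
        have h := hG ⟨0, hm0⟩ j
        rw [hpr, hqs, hs01] at h
        have hnj : ‖ν j‖ = 1 := by
          have := congrArg norm (hG j j)
          rw [norm_mul, norm_mul, _root_.norm_star, hpn _ hji, hqn _ hji, norm_neg, norm_one] at this
          nlinarith [norm_nonneg (ν j)]
        have hrs : r = s := by
          have := congrArg norm h
          rw [norm_mul, norm_mul, _root_.norm_star, hnorm1, hnj, Quaternion.norm_coe,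
            Quaternion.norm_coe, Real.norm_of_nonneg hr.le, Real.norm_of_nonneg hs.le] at this
          linarith
        have hs' : (s : ℍq) ≠ 0 := by
          rw [← norm_ne_zero_iff, Quaternion.norm_coe]
          exact norm_ne_zero_iff.mpr hs.ne'
        rw [hrs, mul_assoc, Quaternion.coe_commutes, ← mul_assoc] at h
        have h' : star (ν ⟨1, hm1⟩) * ν j = 1 :=
          mul_right_cancel₀ hs' (by rw [one_mul]; exact h.symm)
        refine mul_left_cancel₀ hs0 ?_
        rw [hs01, h', hstar_mul]
    intro k j
    rw [hG, hall k, hall j]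
  · rintro ⟨μ, hμ, hG⟩
    obtain ⟨-, -, hp0, -, hp1, -, -⟩ := hp
    obtain ⟨C, hC, hCp⟩ := exists_isometry_of_gram_eq n m (by omega) p
      (fun k j => q k j * μ) (hp0 _ (by simp; omega)) (hp0 _ (by simp; omega))
      (hp1 _ _ rfl (by simp) (by simp; omega))
      (fun k j => by rw [hG, herm_mul_left, herm_mul_right, mul_assoc])
    refine ⟨C, (conjTranspose_mul_qHmat_mul_iff n C).mpr hC, fun _ => μ, fun _ => ?_, hCp⟩
    rw [← norm_ne_zero_iff, hμ]
    exact one_ne_zero
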